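/- Let ⟨−,−⟩: H ⊗ K → k be a dual pairing of Hopf algebras over a field k and let A be a symmetric right partial K-comodule algebra with coaction ρ̄(a) = a⁽⁰⁾ ⊗ a⁽¹⁾. Then the map H ⊗ A → A, h ⊗ a ↦ h·a := a⁽⁰⁾⟨h, a⁽¹⁾⟩, is a symmetric left partial action of H on A, i.e. it satisfies (PLA1), (PLA2), (PLA3) and (PLA3'). -/

import Mathlib

open TensorProduct

/-- `sw2 k f g` is the Sweedler-style map `h ↦ ∑ f(h₍₁₎) * g(h₍₂₎)`. -/
noncomputable def sw2 (k : Type*) [Field k] {H A : Type*}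
    [AddCommGroup H] [Module k H] [Coalgebra k H]
    [Ring A] [Algebra k A] (f g : H →ₗ[k] A) : H →ₗ[k] A :=
  TensorProduct.lift ((LinearMap.mul k A).compl₁₂ f g) ∘ₗ Coalgebra.comul
/-- A symmetric left partial action of a Hopf algebra `H` on a unital algebra `A`:
(PLA1) `1·a = a`; (PLA2) `h·(ab) = ∑ (h₍₁₎·a)(h₍₂₎·b)`;
(PLA3) `h·(g·a) = ∑ (h₍₁₎·1)(h₍₂₎g·a)`; (PLA3') `h·(g·a) = ∑ (h₍₁₎g·a)(h₍₂₎·1)`. -/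
structure IsSymmPartialAction (k : Type*) [Field k] {H A : Type*} [Ring H] [HopfAlgebra k H]
    [Ring A] [Algebra k A] (act : H →ₗ[k] A →ₗ[k] A) : Prop where
  pla1 : ∀ a : A, act 1 a = a
  pla2 : ∀ (h : H) (a b : A), act h (a * b) = sw2 k (act.flip a) (act.flip b) h
  pla3 : ∀ (h g : H) (a : A),
    act h (act g a) = sw2 k (act.flip 1) (act.flip a ∘ₗ LinearMap.mulRight k g) h
  pla3' : ∀ (h g : H) (a : A),
    act h (act g a) = sw2 k (act.flip a ∘ₗ LinearMap.mulRight k g) (act.flip 1) h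
/-- A dual pairing of Hopf algebras `⟨-,-⟩ : H ⊗ K → k`:
`⟨hh',x⟩ = ∑ ⟨h,x₍₁₎⟩⟨h',x₍₂₎⟩`, `⟨1,x⟩ = ε(x)`, `⟨h,xy⟩ = ∑ ⟨h₍₁₎,x⟩⟨h₍₂₎,y⟩`, `⟨h,1⟩ = ε(h)`. -/
structure IsHopfPairing (k : Type*) [Field k] {H K : Type*} [Ring H] [HopfAlgebra k H]
    [Ring K] [HopfAlgebra k K] (p : H →ₗ[k] K →ₗ[k] k) : Prop where
  mul_left : ∀ (h h' : H) (x : K), p (h * h') x = sw2 k (p h) (p h') x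
  one_left : ∀ x : K, p 1 x = Coalgebra.counit x
  mul_right : ∀ (h : H) (x y : K), p h (x * y) = sw2 k (p.flip x) (p.flip y) h
  one_right : ∀ h : H, p h 1 = Coalgebra.counit h
/-- A symmetric right partial coaction of a Hopf algebra `K` on a unital algebra `A`:
(PRHCA1) `ρ(ab) = ρ(a)ρ(b)`; (PRHCA2) `(id ⊗ ε)ρ(a) = a`;
(PRHCA3) `(ρ ⊗ id)ρ(a) = [(id ⊗ Δ)ρ(a)](ρ(1) ⊗ 1)`;
(PRHCA4) `(ρ ⊗ id)ρ(a) = (ρ(1) ⊗ 1)[(id ⊗ Δ)ρ(a)]`. -/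
structure IsSymmRightPartialCoaction (k : Type*) [Field k] {K A : Type*}
    [Ring K] [HopfAlgebra k K] [Ring A] [Algebra k A] (ρ : A →ₗ[k] A ⊗[k] K) : Prop where
  prhca1 : ∀ a b : A, ρ (a * b) = ρ a * ρ b
  prhca2 : ∀ a : A,
    (TensorProduct.rid k A) ((TensorProduct.map LinearMap.id Coalgebra.counit) (ρ a)) = a
  prhca3 : ∀ a : A, (TensorProduct.map ρ LinearMap.id) (ρ a) =
    ((TensorProduct.assoc k A K K).symm
      ((TensorProduct.map LinearMap.id (Coalgebra.comul (R := k))) (ρ a))) * (ρ 1 ⊗ₜ[k] (1 : K))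
  prhca4 : ∀ a : A, (TensorProduct.map ρ LinearMap.id) (ρ a) =
    (ρ 1 ⊗ₜ[k] (1 : K)) * ((TensorProduct.assoc k A K K).symm
      ((TensorProduct.map LinearMap.id (Coalgebra.comul (R := k))) (ρ a)))

namespace PartialCoaction

variable {k H K A B : Type*} [Field k]

/-- Evaluation of the second tensor leg: `b ⊗ x ↦ f(x) b`. -/
noncomputable def evalRight [AddCommGroup K] [Module k K] [AddCommGroup B] [Module k B]
    (f : K →ₗ[k] k) : B ⊗[k] K →ₗ[k] B :=
  (TensorProduct.rid k B).toLinearMap ∘ₗ TensorProduct.map LinearMap.id f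

@[simp]
theorem evalRight_tmul [AddCommGroup K] [Module k K] [AddCommGroup B] [Module k B]
    (f : K →ₗ[k] k) (b : B) (x : K) : evalRight f (b ⊗ₜ[k] x) = f x • b := by
  simp [evalRight]

theorem evalRight_map [AddCommGroup K] [Module k K] [AddCommGroup A] [Module k A]
    [AddCommGroup B] [Module k B] (f : K →ₗ[k] k) (φ : A →ₗ[k] B) (t : A ⊗[k] K) :
    evalRight f (TensorProduct.map φ LinearMap.id t) = φ (evalRight f t) := by
  induction t with
  | zero => simp
  | add s t hs ht => simp only [map_add, hs, ht]
  | tmul a x => simp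

theorem sw2_eq_sum [AddCommGroup H] [Module k H] [Coalgebra k H] [Ring A] [Algebra k A]
    (f g : H →ₗ[k] A) {h : H} {ι : Type*} (s : Finset ι) (l r : ι → H)
    (hs : ∑ i ∈ s, l i ⊗ₜ[k] r i = Coalgebra.comul (R := k) h) :
    sw2 k f g h = ∑ i ∈ s, f (l i) * g (r i) := by
  simp [sw2, ← hs]

variable [Ring B] [Algebra k B] [Ring K]

theorem evalRight_tmul_one_mul [Algebra k K] (f : K →ₗ[k] k) (b : B) (t : B ⊗[k] K) :
    evalRight f ((b ⊗ₜ[k] (1 : K)) * t) = b * evalRight f t := by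
  induction t with
  | zero => simp
  | add s t hs ht => simp only [map_add, mul_add, hs, ht]
  | tmul c x => simp

theorem evalRight_mul_tmul_one [Algebra k K] (f : K →ₗ[k] k) (b : B) (t : B ⊗[k] K) :
    evalRight f (t * (b ⊗ₜ[k] (1 : K))) = evalRight f t * b := by
  induction t with
  | zero => simp
  | add s t hs ht => simp only [map_add, add_mul, hs, ht]
  | tmul c x => simp

variable [Ring H] [HopfAlgebra k H] [HopfAlgebra k K] [Ring A] [Algebra k A]
  {p : H →ₗ[k] K →ₗ[k] k}

theorem evalRight_mul (hp : IsHopfPairing k p) {h : H} {ι : Type*} (I : Finset ι) (l r : ι → H)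
    (hI : ∑ i ∈ I, l i ⊗ₜ[k] r i = Coalgebra.comul (R := k) h) (s t : A ⊗[k] K) :
    evalRight (p h) (s * t) = ∑ i ∈ I, evalRight (p (l i)) s * evalRight (p (r i)) t := by
  induction s with
  | zero => simp
  | add s₁ s₂ h₁ h₂ => simp only [map_add, add_mul, h₁, h₂, Finset.sum_add_distrib]
  | tmul a x =>
    induction t with
    | zero => simp
    | add t₁ t₂ h₁ h₂ => simp only [map_add, mul_add, h₁, h₂, Finset.sum_add_distrib]
    | tmul b y =>
      simp [hp.mul_right, sw2_eq_sum _ _ I l r hI, Finset.sum_smul, smul_smul, mul_comm]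

theorem evalRight_evalRight_comul (hp : IsHopfPairing k p) (h g : H) (t : A ⊗[k] K) :
    evalRight (p h) (evalRight (p g) ((TensorProduct.assoc k A K K).symm
      (TensorProduct.map LinearMap.id (Coalgebra.comul (R := k)) t))) =
    evalRight (p (h * g)) t := by
  induction t with
  | zero => simp
  | add s t hs ht => simp only [map_add, hs, ht]
  | tmul a x =>
    obtain ⟨I, hI⟩ := TensorProduct.exists_finset (Coalgebra.comul (R := k) x)
    have hx := sw2_eq_sum (p h) (p g) I Prod.fst Prod.snd hI.symm
    simp [hp.mul_left, hx, hI, TensorProduct.tmul_sum, Finset.sum_smul, smul_smul, mul_comm]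

end PartialCoaction

open PartialCoaction

/-- Given a dual pairing of Hopf algebras `⟨-,-⟩ : H ⊗ K → k` and a symmetric right partial
`K`-comodule algebra `A`, the map `h·a := a⁽⁰⁾⟨h, a⁽¹⁾⟩` is a symmetric left partial action
of `H` on `A`. -/
theorem partialCoaction_to_partialAction
    {k H K A : Type*} [Field k] [Ring H] [HopfAlgebra k H] [Ring K] [HopfAlgebra k K]
    [Ring A] [Algebra k A]
    (p : H →ₗ[k] K →ₗ[k] k) (hp : IsHopfPairing k p)
    (ρ : A →ₗ[k] A ⊗[k] K) (hρ : IsSymmRightPartialCoaction k ρ)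
    (act : H →ₗ[k] A →ₗ[k] A)
    (hact : ∀ (h : H) (a : A),
      act h a = (TensorProduct.rid k A) ((TensorProduct.map LinearMap.id (p h)) (ρ a))) :
    IsSymmPartialAction k act := by
  have hact' : ∀ (h : H) (a : A), act h a = evalRight (p h) (ρ a) := hact
  have hactact (h g : H) (a : A) : act h (act g a) =
      evalRight (p h) (evalRight (p g) (TensorProduct.map ρ LinearMap.id (ρ a))) := by
    rw [evalRight_map, ← hact', ← hact']
  refine ⟨fun a => ?_, fun h a b => ?_, fun h g a => ?_, fun h g a => ?_⟩
  · rw [hact, show p 1 = Coalgebra.counit from LinearMap.ext hp.one_left, hρ.prhca2]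
  all_goals
    obtain ⟨I, hI⟩ := TensorProduct.exists_finset (Coalgebra.comul (R := k) h)
    rw [sw2_eq_sum _ _ I Prod.fst Prod.snd hI.symm]
  · rw [hact', hρ.prhca1, evalRight_mul hp I Prod.fst Prod.snd hI.symm]
    simp [hact']
  · rw [hactact, hρ.prhca4, evalRight_tmul_one_mul, evalRight_mul hp I Prod.fst Prod.snd hI.symm]
    simp [hact', evalRight_evalRight_comul hp]
  · rw [hactact, hρ.prhca3, evalRight_mul_tmul_one, evalRight_mul hp I Prod.fst Prod.snd hI.symm]
    simp [hact', evalRight_evalRight_comul hp]
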